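/- Let h : ℂ → ℂ be continuous on the closed punctured unit disc {ζ : 0 < |ζ| ≤ 1} and holomorphic on the open punctured unit disc {ζ : 0 < |ζ| < 1}, and suppose that ζ ↦ ζ·h(ζ) extends to a holomorphic function on the whole open unit disc (h has a pole of order at most 1 at 0). Assume Re h(ζ) ≥ 0 for all ζ with |ζ| = 1, and let p be a positive real trigonometric polynomial. Then for every 0 < r < 1, Re( (1/(2πi)) ∮_{|ζ|=r} ζ^{-1} h(ζ) p(ζ) dζ ) ≥ 0, where p(ζ) = ∑_{j=-m}^{m} a_j ζ^j is evaluated as a Laurent polynomial. -/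

import Mathlib

open Complex Metric

/-- The (Laurent) trigonometric polynomial `ζ ↦ ∑_{j=-m}^{m} a j * ζ^j`. -/
noncomputable def trigPoly (m : ℕ) (a : ℤ → ℂ) (ζ : ℂ) : ℂ :=
  ∑ j ∈ Finset.Icc (-(m : ℤ)) (m : ℤ), a j * ζ ^ j

lemma trigPoly_im_eq_zero {m : ℕ} {a : ℤ → ℂ} (hconj : ∀ j : ℤ, a (-j) = starRingEnd ℂ (a j))
    {ζ : ℂ} (hζ : ‖ζ‖ = 1) : (trigPoly m a ζ).im = 0 := by
  rw [← conj_eq_iff_im, trigPoly, map_sum]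
  refine Finset.sum_nbij' (fun j ↦ -j) (fun j ↦ -j) ?_ ?_ ?_ ?_ ?_
  · intro j hj
    rw [Finset.mem_Icc] at hj ⊢
    omega
  · intro j hj
    rw [Finset.mem_Icc] at hj ⊢
    omega
  · simp
  · simp
  · intro j _
    rw [map_mul, map_zpow₀, hconj, ← inv_eq_conj hζ, inv_zpow']

lemma differentiableAt_trigPoly (m : ℕ) (a : ℤ → ℂ) {ζ : ℂ} (hζ : ζ ≠ 0) :
    DifferentiableAt ℂ (trigPoly m a) ζ := by
  unfold trigPoly
  exact DifferentiableAt.fun_sum fun j _ ↦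
    (differentiableAt_zpow.2 (Or.inl hζ)).const_mul (a j)

/-- The circle averages about `0` of a function holomorphic on the punctured unit disc and
continuous up to the unit circle do not depend on the radius. -/
lemma circleAverage_eq_of_differentiableOn_punctured_ball {f : ℂ → ℂ}
    (hc : ContinuousOn f (closedBall 0 1 \ {0})) (hd : DifferentiableOn ℂ f (ball 0 1 \ {0}))
    {r : ℝ} (hr : 0 < r) (hr1 : r ≤ 1) :
    Real.circleAverage f 0 r = Real.circleAverage f 0 1 := by
  rw [Real.circleAverage_eq_circleIntegral hr.ne', Real.circleAverage_eq_circleIntegral one_ne_zero,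
    circleIntegral_sub_center_inv_smul_eq_of_differentiable_on_annulus_off_countable hr hr1
      Set.countable_empty]
  · refine hc.mono fun z hz ↦ ⟨hz.1, ?_⟩
    rintro rfl
    exact hz.2 (mem_ball_self hr)
  · intro z hz
    refine hd.differentiableAt
      ((isOpen_ball.sdiff isClosed_singleton).mem_nhds ⟨hz.1.1, ?_⟩)
    rintro rfl
    exact hz.1.2 (mem_closedBall_self hr.le)

/-- The real part of a circle average is nonnegative if the real part of the function is
nonnegative on the circle. -/
lemma re_circleAverage_nonneg {f : ℂ → ℂ} {c : ℂ} {R : ℝ}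
    (hf : ∀ z ∈ sphere c |R|, 0 ≤ (f z).re) : 0 ≤ (Real.circleAverage f c R).re := by
  by_cases hi : CircleIntegrable f c R
  · rw [← reCLM_apply, ← reCLM.circleAverage_comp_comm hi]
    exact Real.circleAverage_nonneg_of_nonneg hf
  · rw [Real.circleAverage.integral_undef hi, zero_re]

/-- Scalar analytic core of Lemma 4: if `h` is continuous on the closed punctured disc,
holomorphic on the open punctured disc, with a pole of order at most 1 at 0, and
`Re h ≥ 0` on the unit circle, then for every positive real trigonometric polynomial `p`
and every `0 < r < 1`, `Re ((2πi)⁻¹ ∮_{|ζ|=r} ζ⁻¹ h(ζ) p(ζ) dζ) ≥ 0`. -/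
theorem stmt1 (h : ℂ → ℂ)
    (hc : ContinuousOn h (closedBall 0 1 \ {0}))
    (hh : DifferentiableOn ℂ h (ball 0 1 \ {0}))
    (hpole : ∃ H : ℂ → ℂ, DifferentiableOn ℂ H (ball 0 1) ∧
      ∀ ζ ∈ ball (0 : ℂ) 1 \ {0}, H ζ = ζ * h ζ)
    (hre : ∀ ζ : ℂ, ‖ζ‖ = 1 → 0 ≤ (h ζ).re)
    (m : ℕ) (a : ℤ → ℂ)
    (hconj : ∀ j : ℤ, a (-j) = starRingEnd ℂ (a j))
    (hpos : ∀ ζ : ℂ, ‖ζ‖ = 1 → 0 < (trigPoly m a ζ).re) :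
    ∀ r : ℝ, 0 < r → r < 1 →
      0 ≤ ((2 * Real.pi * I)⁻¹ * ∮ z in C(0, r), z⁻¹ * h z * trigPoly m a z).re := by
  intro r hr hr1
  have hp : DifferentiableOn ℂ (trigPoly m a) {0}ᶜ := fun z hz ↦
    (differentiableAt_trigPoly m a hz).differentiableWithinAt
  have hint : (2 * Real.pi * I)⁻¹ * (∮ z in C(0, r), z⁻¹ * h z * trigPoly m a z) =
      Real.circleAverage (h * trigPoly m a) 0 r := by
    simp [Real.circleAverage_eq_circleIntegral hr.ne', mul_assoc]
  rw [hint, circleAverage_eq_of_differentiableOn_punctured_ball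
    (hc.mul (hp.continuousOn.mono fun z hz ↦ hz.2)) (hh.mul (hp.mono fun z hz ↦ hz.2)) hr hr1.le]
  refine re_circleAverage_nonneg fun z hz ↦ ?_
  have hz1 : ‖z‖ = 1 := by simpa using hz
  rw [Pi.mul_apply, mul_re, trigPoly_im_eq_zero hconj hz1, mul_zero, sub_zero]
  exact mul_nonneg (hre z hz1) (hpos z hz1).le
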